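/- Let X = ℝ with the Borel σ-algebra, let μ be the probability measure with density h(x) = (1/2)·e^{−|x|} with respect to Lebesgue measure (the standard Laplace distribution), let f(x) = x + 1, and let 1 ≤ p < ∞. Then the composition operator T_f(φ) = φ ∘ f is a well-defined invertible bounded linear operator on L^p(ℝ, μ), and T_f is generalized hyperbolic (in particular, T_f has the shadowing property). -/

import Mathlib

open MeasureTheory Filter Set Function Topology ENNReal

noncomputable section

namespace GHShadow

/-- The shadowing property for an invertible bounded linear operator. -/
def HasShadowing {E : Type*} [NormedAddCommGroup E] [NormedSpace ℝ E]
    (T : E ≃L[ℝ] E) : Prop :=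
  ∀ ε : ℝ, 0 < ε → ∃ δ : ℝ, 0 < δ ∧ ∀ x : ℤ → E,
    (∀ n : ℤ, ‖T (x n) - x (n + 1)‖ ≤ δ) →
      ∃ y : E, ∀ n : ℤ, ‖(T ^ n) y - x n‖ < ε

/-- `lim ‖Tⁿ‖^{1/n}` exists and is `< 1`. -/
def SpectralRadiusLtOne {E : Type*} [NormedAddCommGroup E] [NormedSpace ℝ E]
    (T : E →L[ℝ] E) : Prop :=
  ∃ r : ℝ, r < 1 ∧ Tendsto (fun n : ℕ => ‖T ^ n‖ ^ (1 / (n : ℝ))) atTop (nhds r)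

/-- The restriction of `T` to `M` has spectral radius `< 1`
(equivalently, is a proper contraction in an equivalent norm). -/
def ContractsOn {E : Type*} [NormedAddCommGroup E] [NormedSpace ℝ E]
    (T : E ≃L[ℝ] E) (M : Submodule ℝ E) : Prop :=
  ∃ C : ℝ, 0 < C ∧ ∃ t : ℝ, 0 < t ∧ t < 1 ∧
    ∀ n : ℕ, ∀ x ∈ M, ‖(T ^ n) x‖ ≤ C * t ^ n * ‖x‖

def GeneralizedHyperbolic {E : Type*} [NormedAddCommGroup E] [NormedSpace ℝ E]
    (T : E ≃L[ℝ] E) : Prop :=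
  ∃ M N : Submodule ℝ E, IsClosed (M : Set E) ∧ IsClosed (N : Set E) ∧
    IsCompl M N ∧ (∀ x ∈ M, T x ∈ M) ∧ (∀ x ∈ N, T.symm x ∈ N) ∧
    ContractsOn T M ∧ ContractsOn T.symm N

variable {X : Type*} [MeasurableSpace X]

/-- image of `B` under the `k`-th iterate of the invertible map `f`. -/
def img (f : Equiv.Perm X) (k : ℤ) (B : Set X) : Set X := ⇑(f ^ k) '' B

/-- `(X, 𝓑, μ, f)` is a dissipative system generated by `W`. -/
structure IsDissipative (μ : Measure X) (f : Equiv.Perm X) (W : Set X) : Prop where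
  sigmaFin : SigmaFinite μ
  meas_f : Measurable f
  meas_symm : Measurable f.symm
  meas_W : MeasurableSet W
  pos : 0 < μ W
  fin : μ W < ⊤
  disj : Pairwise fun k l : ℤ => Disjoint (img f k W) (img f l W)
  cover : (⋃ k : ℤ, img f k W) = univ

/-- `f` is of bounded distortion on `W` with constant `K`. -/
def BoundedDistortion (μ : Measure X) (f : Equiv.Perm X) (W : Set X) (K : ℝ≥0∞) : Prop :=
  ∀ k : ℤ, ∀ B : Set X, MeasurableSet B → B ⊆ W →
    (1 / K) * (μ (img f k W) * μ B) ≤ μ (img f k B) * μ W ∧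
      μ (img f k B) * μ W ≤ K * (μ (img f k W) * μ B)

/-- condition (⋆) for a transformation `g`. -/
def CondStar (μ : Measure X) (g : X → X) : Prop :=
  ∃ c : ℝ≥0∞, 0 < c ∧ c ≠ ⊤ ∧ ∀ B : Set X, MeasurableSet B → μ (g ⁻¹' B) ≤ c * μ B

/-- condition 𝓗𝓒. -/
def CondHC (μ : Measure X) (f : Equiv.Perm X) (W : Set X) : Prop :=
  limsup (fun n : ℕ =>
    ⨆ k : ℤ, (μ (img f k W) / μ (img f (k + (n : ℤ)) W)) ^ (1 / (n : ℝ))) atTop < 1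

/-- condition 𝓗𝓓. -/
def CondHD (μ : Measure X) (f : Equiv.Perm X) (W : Set X) : Prop :=
  1 < liminf (fun n : ℕ =>
    ⨅ k : ℤ, (μ (img f k W) / μ (img f (k + (n : ℤ)) W)) ^ (1 / (n : ℝ))) atTop

/-- condition 𝓖𝓗. -/
def CondGH (μ : Measure X) (f : Equiv.Perm X) (W : Set X) : Prop :=
  limsup (fun n : ℕ =>
      ⨆ m : ℕ, (μ (img f (-(m : ℤ) - (n : ℤ)) W) / μ (img f (-(m : ℤ)) W)) ^ (1 / (n : ℝ)))
      atTop < 1 ∧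
  1 < liminf (fun n : ℕ =>
      ⨅ m : ℕ, (μ (img f (m : ℤ) W) / μ (img f ((m : ℤ) + (n : ℤ)) W)) ^ (1 / (n : ℝ))) atTop

/-- `T` represents the composition operator `φ ↦ φ ∘ f` on `L^p(X,μ)`. -/
def RepsComp (μ : Measure X) (p : ℝ≥0∞) [Fact (1 ≤ p)] (f : X → X)
    (T : Lp ℝ p μ ≃L[ℝ] Lp ℝ p μ) : Prop :=
  ∀ φ : Lp ℝ p μ, ⇑(T φ) =ᵐ[μ] fun x => (φ : X → ℝ) (f x)


/-- The standard Laplace distribution on `ℝ`: density `(1/2)e^{-|x|}` w.r.t. Lebesgue. -/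
def laplaceMeasure : Measure ℝ :=
  (volume : Measure ℝ).withDensity fun x => ENNReal.ofReal ((1 / 2) * Real.exp (-|x|))

section Shadowing

variable {E : Type*} [NormedAddCommGroup E] [NormedSpace ℝ E]

theorem ContractsOn.of_norm_apply_le {T : E ≃L[ℝ] E} {M : Submodule ℝ E} {t : ℝ}
    (ht0 : 0 < t) (ht1 : t < 1) (hM : ∀ x ∈ M, T x ∈ M) (h : ∀ x ∈ M, ‖T x‖ ≤ t * ‖x‖) :
    ContractsOn T M := by
  refine ⟨1, one_pos, t, ht0, ht1, fun n => ?_⟩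
  induction n with
  | zero => intro x _; rw [pow_zero, pow_zero, one_mul, one_mul]; rfl
  | succ n ih =>
    intro x hx
    calc ‖(T ^ (n + 1)) x‖ = ‖(T ^ n) (T x)‖ := by rw [pow_succ]; rfl
      _ ≤ 1 * t ^ n * ‖T x‖ := ih _ (hM x hx)
      _ ≤ 1 * t ^ n * (t * ‖x‖) := by gcongr; exact h x hx
      _ = 1 * t ^ (n + 1) * ‖x‖ := by ring

/-- Bounded perturbations of a contracting direction admit a bounded solution of the
inhomogeneous equation `e (n + 1) = T (e n) - z n`. -/
theorem ContractsOn.exists_bounded_solution [CompleteSpace E] {T : E ≃L[ℝ] E}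
    {M : Submodule ℝ E} (h : ContractsOn T M) :
    ∃ K : ℝ, 0 < K ∧ ∀ δ : ℝ, ∀ z : ℤ → E, (∀ n, z n ∈ M) → (∀ n, ‖z n‖ ≤ δ) →
      ∃ e : ℤ → E, ∀ n, e (n + 1) = T (e n) - z n ∧ ‖e n‖ ≤ K * δ := by
  obtain ⟨C, hC, t, ht0, ht1, hT⟩ := h
  refine ⟨C * (1 - t)⁻¹, mul_pos hC (inv_pos.2 (sub_pos.2 ht1)), fun δ z hzM hz => ?_⟩
  have hgeom : HasSum (fun k : ℕ => C * t ^ k * δ) (C * (1 - t)⁻¹ * δ) :=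
    ((hasSum_geometric_of_lt_one ht0.le ht1).mul_left C).mul_right δ
  have hbound (n : ℤ) (k : ℕ) : ‖(T ^ k) (z (n - 1 - k))‖ ≤ C * t ^ k * δ :=
    (hT k _ (hzM _)).trans (by gcongr; exact hz _)
  have hsum (n : ℤ) : Summable fun k : ℕ => (T ^ k) (z (n - 1 - k)) :=
    .of_norm_bounded hgeom.summable (hbound n)
  refine ⟨fun n => -∑' k : ℕ, (T ^ k) (z (n - 1 - k)), fun n => ⟨?_, ?_⟩⟩
  · have hstep (k : ℕ) :
        (T ^ (k + 1)) (z (n + 1 - 1 - ((k + 1 : ℕ) : ℤ))) = T ((T ^ k) (z (n - 1 - k))) := by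
      rw [pow_succ', show n + 1 - 1 - ((k + 1 : ℕ) : ℤ) = n - 1 - k by push_cast; ring]
      rfl
    simp only
    rw [(hsum (n + 1)).tsum_eq_zero_add, map_neg, T.map_tsum]
    simp only [hstep]
    simp
    abel
  · rw [norm_neg]
    exact tsum_of_norm_bounded hgeom (hbound n)

theorem zpow_apply_eq_of_step {T : E ≃L[ℝ] E} {w : ℤ → E} (hw : ∀ n, w (n + 1) = T (w n))
    (n : ℤ) : (T ^ n) (w 0) = w n := by
  induction n using Int.induction_on with
  | zero => rw [zpow_zero]; rfl
  | succ n ih => rw [add_comm, zpow_add, zpow_one, add_comm, hw, ← ih]; rfl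
  | pred n ih =>
    apply T.injective
    rw [← hw, sub_add_cancel, ← ih, sub_eq_neg_add, zpow_add, zpow_neg_one]
    exact T.apply_symm_apply _

theorem GeneralizedHyperbolic.hasShadowing [CompleteSpace E] {T : E ≃L[ℝ] E}
    (h : GeneralizedHyperbolic T) : HasShadowing T := by
  obtain ⟨M, N, hM, hN, hMN, -, hNinv, hTM, hTN⟩ := h
  have hc := Submodule.IsCompl.isTopCompl_of_isClosed hMN hM hN
  set P := M.projectionL N hc
  set Q := N.projectionL M hc.symm
  obtain ⟨K, hK, hsolM⟩ := hTM.exists_bounded_solution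
  obtain ⟨L, hL, hsolN⟩ := hTN.exists_bounded_solution
  set S : E →L[ℝ] E := (T.symm : E →L[ℝ] E)
  set A : ℝ := K * ‖P‖ + L * (‖S‖ * ‖Q‖) with hA
  have hA0 : 0 ≤ A := by positivity
  intro ε hε
  refine ⟨ε / (A + 1), by positivity, fun x hx => ?_⟩
  set δ : ℝ := ε / (A + 1) with hδ
  set z : ℤ → E := fun n => x (n + 1) - T (x n) with hz
  have hzδ (n : ℤ) : ‖z n‖ ≤ δ := by rw [hz, norm_sub_rev]; exact hx n
  obtain ⟨u, hu⟩ := hsolM (‖P‖ * δ) (fun n => P (z n))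
    (fun n => Submodule.projectionL_apply_mem hc _)
    (fun n => P.le_opNorm_of_le (hzδ n))
  obtain ⟨v, hv⟩ := hsolN (‖S‖ * (‖Q‖ * δ)) (fun n => -T.symm (Q (z (-n - 1))))
    (fun n => N.neg_mem (hNinv _ (Submodule.projectionL_apply_mem hc.symm _)))
    (fun n => by
      rw [norm_neg]
      exact S.le_opNorm_of_le (Q.le_opNorm_of_le (hzδ _)))
  have hvstep (n : ℤ) : v (-(n + 1)) = T (v (-n)) - Q (z n) := by
    have := congrArg T (hv (-(n + 1))).1
    simp only [sub_neg_eq_add, map_add, T.apply_symm_apply] at this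
    rw [show -(n + 1) + 1 = -n by ring, show -(-(n + 1)) - 1 = n by ring] at this
    rw [this, add_sub_cancel_right]
  have hPQ (y : E) : P y + Q y = y := Submodule.projectionL_add_projectionL_eq_self hc y
  have hw (n : ℤ) : x (n + 1) + u (n + 1) + v (-(n + 1)) = T (x n + u n + v (-n)) := by
    rw [(hu n).1, hvstep, map_add, map_add]
    have hn : P (z n) + Q (z n) = x (n + 1) - T (x n) := hPQ _
    have hxn : x (n + 1) = P (z n) + Q (z n) + T (x n) := by rw [hn]; abel
    rw [hxn]
    abel
  refine ⟨x 0 + u 0 + v (-0), fun n => ?_⟩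
  rw [zpow_apply_eq_of_step (w := fun n => x n + u n + v (-n)) hw n]
  calc ‖x n + u n + v (-n) - x n‖ = ‖u n + v (-n)‖ := by congr 1; abel
    _ ≤ K * (‖P‖ * δ) + L * (‖S‖ * (‖Q‖ * δ)) :=
      norm_add_le_of_le (hu n).2 (hv (-n)).2
    _ = A * δ := by rw [hA]; ring
    _ < (A + 1) * δ := by
      have : 0 < δ := by positivity
      linarith
    _ = ε := by rw [hδ]; field_simp

end Shadowing

section Composition

variable {μ : Measure X} {f : X → X} {p c : ℝ≥0∞}

theorem quasiMeasurePreserving_of_map_le (hf : Measurable f) (hle : μ.map f ≤ c • μ) :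
    Measure.QuasiMeasurePreserving f μ μ :=
  ⟨hf, (Measure.absolutelyContinuous_of_le hle).trans (Measure.smul_absolutelyContinuous)⟩

theorem eLpNorm_comp_le_of_restrict_map_le (hp : p ≠ ⊤)
    (hf : Measure.QuasiMeasurePreserving f μ μ) {s : Set X} (hs : MeasurableSet s)
    (hle : (μ.map f).restrict s ≤ c • μ) {φ : X → ℝ} (hφ : AEStronglyMeasurable φ μ)
    (hφs : ∀ᵐ x ∂μ, x ∈ sᶜ → φ x = 0) :
    eLpNorm (φ ∘ f) p μ ≤ c ^ (1 / p).toReal * eLpNorm φ p μ := by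
  have hind : φ =ᵐ[μ.map f] s.indicator φ := by
    filter_upwards [hf.absolutelyContinuous.ae_le hφs] with x hx
    by_cases hxs : x ∈ s
    · simp [hxs]
    · simp [hxs, hx hxs]
  calc eLpNorm (φ ∘ f) p μ = eLpNorm φ p (μ.map f) :=
        (eLpNorm_map_measure (hφ.mono_ac hf.absolutelyContinuous) hf.aemeasurable).symm
    _ = eLpNorm φ p ((μ.map f).restrict s) := by
        rw [eLpNorm_congr_ae hind, eLpNorm_indicator_eq_eLpNorm_restrict hs]
    _ ≤ eLpNorm φ p (c • μ) := eLpNorm_mono_measure _ hle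
    _ = c ^ (1 / p).toReal * eLpNorm φ p μ := by
        rw [eLpNorm_smul_measure_of_ne_top hp, smul_eq_mul]

/-- The composition operator `φ ↦ φ ∘ f` on `L^p`, when the push-forward of `μ` under `f` is
dominated by a multiple of `μ`. -/
def compLp [Fact (1 ≤ p)] (hp : p ≠ ⊤) (hf : Measurable f) (hc : c ≠ ⊤)
    (hle : μ.map f ≤ c • μ) : Lp ℝ p μ →L[ℝ] Lp ℝ p μ :=
  have hq := quasiMeasurePreserving_of_map_le hf hle
  have hmem (φ : Lp ℝ p μ) : MemLp (φ ∘ f) p μ :=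
    ((Lp.memLp φ).of_measure_le_smul hc hle).comp_of_map hf.aemeasurable
  LinearMap.mkContinuous
    { toFun := fun φ => (hmem φ).toLp _
      map_add' := fun φ ψ => by
        rw [← MemLp.toLp_add]
        exact MemLp.toLp_congr _ _ (hq.ae_eq_comp (Lp.coeFn_add φ ψ))
      map_smul' := fun a φ => by
        rw [RingHom.id_apply, ← MemLp.toLp_const_smul]
        exact MemLp.toLp_congr _ _ (hq.ae_eq_comp (Lp.coeFn_smul a φ)) }
    (c ^ (1 / p).toReal).toReal
    (fun φ => by
      have h := eLpNorm_comp_le_of_restrict_map_le hp hq MeasurableSet.univ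
        (by rwa [Measure.restrict_univ]) (Lp.aestronglyMeasurable φ) (by simp)
      change ‖(hmem φ).toLp _‖ ≤ _
      rw [Lp.norm_toLp, Lp.norm_def, ← ENNReal.toReal_mul]
      exact ENNReal.toReal_mono (ENNReal.mul_ne_top
        (ENNReal.rpow_ne_top_of_nonneg ENNReal.toReal_nonneg hc) (Lp.eLpNorm_ne_top φ)) h)

theorem coeFn_compLp [Fact (1 ≤ p)] (hp : p ≠ ⊤) (hf : Measurable f) (hc : c ≠ ⊤)
    (hle : μ.map f ≤ c • μ) (φ : Lp ℝ p μ) :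
    compLp hp hf hc hle φ =ᵐ[μ] fun x => φ (f x) :=
  MemLp.coeFn_toLp (((Lp.memLp φ).of_measure_le_smul hc hle).comp_of_map hf.aemeasurable)

/-- The invertible composition operator `φ ↦ φ ∘ f` on `L^p` with inverse `φ ↦ φ ∘ f⁻¹`. -/
def compLpEquiv [Fact (1 ≤ p)] (hp : p ≠ ⊤) (f : X ≃ᵐ X) (hc : c ≠ ⊤)
    (hle : μ.map f ≤ c • μ) (hle' : μ.map f.symm ≤ c • μ) : Lp ℝ p μ ≃L[ℝ] Lp ℝ p μ :=
  ContinuousLinearEquiv.equivOfInverse (compLp hp f.measurable hc hle)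
    (compLp hp f.symm.measurable hc hle')
    (fun φ => Lp.ext <| by
      filter_upwards [coeFn_compLp hp f.symm.measurable hc hle' (compLp hp f.measurable hc hle φ),
        (quasiMeasurePreserving_of_map_le f.symm.measurable hle').ae
          (coeFn_compLp hp f.measurable hc hle φ)] with x h1 h2
      rw [h1, h2, f.apply_symm_apply])
    (fun φ => Lp.ext <| by
      filter_upwards [coeFn_compLp hp f.measurable hc hle (compLp hp f.symm.measurable hc hle' φ),
        (quasiMeasurePreserving_of_map_le f.measurable hle).ae
          (coeFn_compLp hp f.symm.measurable hc hle' φ)] with x h1 h2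
      rw [h1, h2, f.symm_apply_apply])

/-- The subspace of `L^p` functions vanishing almost everywhere on `A`. -/
def vanishingOn [Fact (1 ≤ p)] (μ : Measure X) (A : Set X) : Submodule ℝ (Lp ℝ p μ) :=
  (LpToLpRestrictCLM X ℝ ℝ μ p A).ker

theorem isClosed_vanishingOn [Fact (1 ≤ p)] (μ : Measure X) (A : Set X) :
    IsClosed ((vanishingOn μ A : Submodule ℝ (Lp ℝ p μ)) : Set (Lp ℝ p μ)) :=
  (LpToLpRestrictCLM X ℝ ℝ μ p A).isClosed_ker

theorem mem_vanishingOn [Fact (1 ≤ p)] {A : Set X} (hA : MeasurableSet A) {φ : Lp ℝ p μ} :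
    φ ∈ vanishingOn μ A ↔ ∀ᵐ x ∂μ, x ∈ A → φ x = 0 := by
  rw [← ae_restrict_iff' hA, vanishingOn, LinearMap.mem_ker, Lp.eq_zero_iff_ae_eq_zero]
  have h := LpToLpRestrictCLM_coeFn ℝ A φ
  exact ⟨fun h0 => h.symm.trans h0, fun h0 => h.trans h0⟩

theorem isCompl_vanishingOn [Fact (1 ≤ p)] {A : Set X} (hA : MeasurableSet A) :
    IsCompl (vanishingOn (p := p) μ A) (vanishingOn μ Aᶜ) := by
  refine ⟨Submodule.disjoint_def.2 fun φ h1 h2 => ?_, codisjoint_iff.2 (eq_top_iff.2 ?_)⟩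
  · rw [mem_vanishingOn hA] at h1
    rw [mem_vanishingOn hA.compl] at h2
    rw [Lp.eq_zero_iff_ae_eq_zero]
    filter_upwards [h1, h2] with x hx1 hx2
    exact (em (x ∈ A)).elim hx1 hx2
  · intro φ _
    have h1 := (Lp.memLp φ).indicator hA
    have h2 := (Lp.memLp φ).indicator hA.compl
    refine Submodule.mem_sup.2 ⟨h2.toLp _, ?_, h1.toLp _, ?_, ?_⟩
    · rw [mem_vanishingOn hA]
      filter_upwards [h2.coeFn_toLp] with x hx hxA
      simp [hx, hxA]
    · rw [mem_vanishingOn hA.compl]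
      filter_upwards [h1.coeFn_toLp] with x hx hxA
      rw [hx, indicator_of_notMem hxA]
    · rw [← MemLp.toLp_add]
      simp only [indicator_compl_add_self]
      exact Lp.toLp_coeFn φ (Lp.memLp φ)

theorem compLp_mem_vanishingOn [Fact (1 ≤ p)] (hp : p ≠ ⊤) (hf : Measurable f) (hc : c ≠ ⊤)
    (hle : μ.map f ≤ c • μ) {A : Set X} (hA : MeasurableSet A) (hfA : MapsTo f A A)
    {φ : Lp ℝ p μ} (hφ : φ ∈ vanishingOn μ A) : compLp hp hf hc hle φ ∈ vanishingOn μ A := by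
  rw [mem_vanishingOn hA] at hφ ⊢
  filter_upwards [coeFn_compLp hp hf hc hle φ,
    (quasiMeasurePreserving_of_map_le hf hle).ae hφ] with x h1 h2 hx
  rw [h1, h2 (hfA hx)]

theorem norm_compLp_le [Fact (1 ≤ p)] (hp : p ≠ ⊤) (hf : Measurable f) (hc : c ≠ ⊤)
    (hle : μ.map f ≤ c • μ) {A : Set X} (hA : MeasurableSet A) {b : ℝ≥0∞} (hb : b ≠ ⊤)
    (hbA : (μ.map f).restrict Aᶜ ≤ b • μ) {φ : Lp ℝ p μ} (hφ : φ ∈ vanishingOn μ A) :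
    ‖compLp hp hf hc hle φ‖ ≤ (b ^ (1 / p).toReal).toReal * ‖φ‖ := by
  rw [mem_vanishingOn hA] at hφ
  have h := eLpNorm_comp_le_of_restrict_map_le hp (quasiMeasurePreserving_of_map_le hf hle)
    hA.compl hbA (Lp.aestronglyMeasurable φ) (by simpa using hφ)
  rw [Lp.norm_def, Lp.norm_def, ← ENNReal.toReal_mul,
    eLpNorm_congr_ae (coeFn_compLp hp hf hc hle φ)]
  exact ENNReal.toReal_mono (ENNReal.mul_ne_top
    (ENNReal.rpow_ne_top_of_nonneg ENNReal.toReal_nonneg hb) (Lp.eLpNorm_ne_top φ)) h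

/-- If `f` maps `A` into itself, `f⁻¹` maps `Aᶜ` into itself, and the push-forwards of `μ` under
`f` and `f⁻¹` are strictly contracted on `Aᶜ` and `A` respectively, then the composition operator
is generalized hyperbolic. -/
theorem generalizedHyperbolic_compLpEquiv [Fact (1 ≤ p)] (hp : p ≠ ⊤) (f : X ≃ᵐ X) (hc : c ≠ ⊤)
    (hle : μ.map f ≤ c • μ) (hle' : μ.map f.symm ≤ c • μ) {A : Set X} (hA : MeasurableSet A)
    (hfA : MapsTo f A A) (hfA' : MapsTo f.symm Aᶜ Aᶜ) {b : ℝ≥0∞} (hb0 : b ≠ 0) (hb1 : b < 1)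
    (hbA : (μ.map f).restrict Aᶜ ≤ b • μ) (hbA' : (μ.map f.symm).restrict A ≤ b • μ) :
    GeneralizedHyperbolic (compLpEquiv hp f hc hle hle') := by
  have hp1 : 1 ≤ p := Fact.out
  have hpos : 0 < (1 / p).toReal :=
    ENNReal.toReal_pos (by simp [hp]) (by simpa using (zero_lt_one.trans_le hp1).ne')
  have hb : b ≠ ⊤ := (hb1.trans ENNReal.one_lt_top).ne
  have ht1 : b ^ (1 / p).toReal < 1 := ENNReal.rpow_lt_one hb1 hpos
  have ht0 : 0 < (b ^ (1 / p).toReal).toReal :=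
    ENNReal.toReal_pos (ENNReal.rpow_pos (pos_iff_ne_zero.2 hb0) hb).ne' ht1.ne_top
  have ht1' : (b ^ (1 / p).toReal).toReal < 1 := by
    simpa using (ENNReal.toReal_lt_toReal ht1.ne_top ENNReal.one_ne_top).2 ht1
  have hM : ∀ φ ∈ vanishingOn (p := p) μ A, compLpEquiv hp f hc hle hle' φ ∈ vanishingOn μ A :=
    fun φ hφ => compLp_mem_vanishingOn hp f.measurable hc hle hA hfA hφ
  have hN : ∀ φ ∈ vanishingOn (p := p) μ Aᶜ,
      (compLpEquiv hp f hc hle hle').symm φ ∈ vanishingOn μ Aᶜ :=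
    fun φ hφ => compLp_mem_vanishingOn hp f.symm.measurable hc hle' hA.compl hfA' hφ
  refine ⟨vanishingOn μ A, vanishingOn μ Aᶜ, isClosed_vanishingOn μ A, isClosed_vanishingOn μ Aᶜ,
    isCompl_vanishingOn hA, hM, hN, .of_norm_apply_le ht0 ht1' hM fun φ hφ => ?_,
    .of_norm_apply_le ht0 ht1' hN fun φ hφ => ?_⟩
  · exact norm_compLp_le hp f.measurable hc hle hA hb hbA hφ
  · exact norm_compLp_le hp f.symm.measurable hc hle' hA.compl hb (by rwa [compl_compl]) hφ

end Composition

theorem restrict_map_add_right_laplaceMeasure_le (a r : ℝ) {s : Set ℝ} (hs : MeasurableSet s)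
    (h : ∀ y ∈ s, |y| ≤ |y - a| + r) :
    (laplaceMeasure.map (· + a)).restrict s ≤ ENNReal.ofReal (Real.exp r) • laplaceMeasure := by
  refine Measure.le_iff.2 fun B hB => ?_
  have hBs := hB.inter hs
  calc (laplaceMeasure.map (· + a)).restrict s B
      = ∫⁻ x in (· + a) ⁻¹' (B ∩ s), ENNReal.ofReal ((1 / 2) * Real.exp (-|x|)) := by
        rw [Measure.restrict_apply hB, Measure.map_apply (measurable_add_const a) hBs,
          laplaceMeasure, withDensity_apply _ (measurable_add_const a hBs)]
    _ = ∫⁻ y in B ∩ s, ENNReal.ofReal ((1 / 2) * Real.exp (-|y - a|)) := by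
        rw [← (measurePreserving_add_right volume a).setLIntegral_comp_preimage hBs
          (by fun_prop)]
        simp
    _ ≤ ∫⁻ y in B ∩ s, ENNReal.ofReal (Real.exp r) *
          ENNReal.ofReal ((1 / 2) * Real.exp (-|y|)) := by
        refine setLIntegral_mono' hBs fun y hy => ?_
        rw [← ENNReal.ofReal_mul (Real.exp_pos r).le]
        refine ENNReal.ofReal_le_ofReal ?_
        rw [mul_left_comm, ← Real.exp_add]
        gcongr
        linarith [h y hy.2]
    _ ≤ ∫⁻ y in B, ENNReal.ofReal (Real.exp r) *
          ENNReal.ofReal ((1 / 2) * Real.exp (-|y|)) := lintegral_mono_set inter_subset_left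
    _ = (ENNReal.ofReal (Real.exp r) • laplaceMeasure) B := by
        rw [lintegral_const_mul _ (by fun_prop), Measure.smul_apply, laplaceMeasure,
          withDensity_apply _ hB, smul_eq_mul]

theorem map_add_right_laplaceMeasure_le {a : ℝ} (ha : |a| ≤ 1) :
    laplaceMeasure.map (· + a) ≤ ENNReal.ofReal (Real.exp 1) • laplaceMeasure := by
  rw [← Measure.restrict_univ (μ := laplaceMeasure.map (· + a))]
  refine restrict_map_add_right_laplaceMeasure_le a 1 MeasurableSet.univ fun y _ => ?_
  linarith [abs_sub_abs_le_abs_sub y a]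

/-- Example `Lap`: for the standard Laplace distribution `μ` on `ℝ` and
`f(x) = x + 1`, the composition operator `T_f φ = φ ∘ f` is a well-defined invertible
bounded linear operator on `L^p(ℝ, μ)` which is generalized hyperbolic (in particular it
has the shadowing property). -/
theorem laplace_composition_generalizedHyperbolic
    (p : ℝ≥0∞) [Fact (1 ≤ p)] (hp : p ≠ ⊤) :
    ∃ T : Lp ℝ p laplaceMeasure ≃L[ℝ] Lp ℝ p laplaceMeasure,
      (∀ φ : Lp ℝ p laplaceMeasure,
        ⇑(T φ) =ᵐ[laplaceMeasure] fun x => (φ : ℝ → ℝ) (x + 1)) ∧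
      GeneralizedHyperbolic T ∧ HasShadowing T := by
  obtain ⟨f, hfun, hsymm⟩ : ∃ f : ℝ ≃ᵐ ℝ, ⇑f = (· + 1) ∧ ⇑f.symm = (· + (-1)) :=
    ⟨MeasurableEquiv.addRight 1, rfl, rfl⟩
  have hle : laplaceMeasure.map f ≤ ENNReal.ofReal (Real.exp 1) • laplaceMeasure := by
    rw [hfun]; exact map_add_right_laplaceMeasure_le (by simp)
  have hle' : laplaceMeasure.map f.symm ≤ ENNReal.ofReal (Real.exp 1) • laplaceMeasure := by
    rw [hsymm]; exact map_add_right_laplaceMeasure_le (by simp)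
  have hgh : GeneralizedHyperbolic (compLpEquiv hp f ENNReal.ofReal_ne_top hle hle') := by
    refine generalizedHyperbolic_compLpEquiv hp f ENNReal.ofReal_ne_top hle hle'
      (A := Ioi 0) (b := ENNReal.ofReal (Real.exp (-1))) measurableSet_Ioi ?_ ?_ ?_ ?_ ?_ ?_
    · intro x (hx : 0 < x)
      rw [hfun, mem_Ioi]
      linarith
    · intro x hx
      rw [compl_Ioi, mem_Iic] at hx ⊢
      rw [hsymm]
      linarith
    · simp [Real.exp_pos]
    · simp
    · rw [hfun]
      refine restrict_map_add_right_laplaceMeasure_le 1 (-1) measurableSet_Ioi.compl fun y hy => ?_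
      rw [compl_Ioi, mem_Iic] at hy
      rw [abs_of_nonpos hy, abs_of_nonpos (by linarith)]
      linarith
    · rw [hsymm]
      refine restrict_map_add_right_laplaceMeasure_le (-1) (-1) measurableSet_Ioi
        fun y (hy : 0 < y) => ?_
      rw [abs_of_pos hy, abs_of_pos (by linarith)]
      linarith
  refine ⟨compLpEquiv hp f ENNReal.ofReal_ne_top hle hle', fun φ => ?_, hgh, hgh.hasShadowing⟩
  have h := coeFn_compLp hp f.measurable ENNReal.ofReal_ne_top hle φ
  have hcomp : (fun x => φ (f x)) = fun x => φ (x + 1) := by rw [hfun]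
  exact hcomp ▸ h

end GHShadow
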